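/- Let f : ℂ^{n+1} → ℝ be smooth, p a point with ∇f(p) ≠ 0 (∇f the gradient with respect to the real inner product Re⟨·,·⟩), and let M = f⁻¹(0) ∋ p. Set ν = ∇f(p)/|∇f(p)| (viewed as a vector in ℂ^{n+1}), N = −ν the inner unit normal, T = iN the characteristic direction, and define: the second fundamental form h(v,w) = Hess f(p)(v,w)/|∇f(p)| for v, w tangent to M at p; the mean curvature H = (1/(2n+1))·∑_{a=1}^{2n+1} h(v_a, v_a) over any real orthonormal basis v₁,…,v_{2n+1} of the tangent space T_pM = {v : Re⟨v, ∇f(p)⟩ = 0}; the characteristic curvature C^T = h(T,T); and the Levi-mean curvature L = (2/(n·|∇f(p)|))·( ∑_{j=1}^{n+1} (∂²f/∂z_j∂z̄_j)(p) − ∑_{j,k=1}^{n+1} (∂²f/∂z_j∂z̄_k)(p)·ν_j·conj(ν_k) ). Then (2n+1)·H = 2n·L + C^T. -/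

import Mathlib

open scoped RealInnerProductSpace ContDiff

/-- The Wirtinger derivative `∂f/∂z̄ₖ = (1/2)(∂f/∂xₖ + i ∂f/∂yₖ)` of a real-valued
function `f` on `ℂ^{n+1}`, at the point `z`. -/
noncomputable def wirtingerDZbar (n : ℕ) (f : EuclideanSpace ℂ (Fin (n+1)) → ℝ)
    (k : Fin (n+1)) (z : EuclideanSpace ℂ (Fin (n+1))) : ℂ :=
  (1 / 2 : ℂ) * ((fderiv ℝ f z (EuclideanSpace.single k 1) : ℂ) +
    Complex.I * (fderiv ℝ f z (EuclideanSpace.single k Complex.I) : ℂ))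

/-- The complex Hessian `∂²f/∂zⱼ∂z̄ₖ = (1/2)(∂/∂xⱼ − i ∂/∂yⱼ)(∂f/∂z̄ₖ)` of a real-valued
function `f` on `ℂ^{n+1}`, at the point `p`. -/
noncomputable def complexHessian (n : ℕ) (f : EuclideanSpace ℂ (Fin (n+1)) → ℝ)
    (j k : Fin (n+1)) (p : EuclideanSpace ℂ (Fin (n+1))) : ℂ :=
  (1 / 2 : ℂ) * (fderiv ℝ (wirtingerDZbar n f k) p (EuclideanSpace.single j 1) -
    Complex.I * fderiv ℝ (wirtingerDZbar n f k) p (EuclideanSpace.single j Complex.I))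

/-- The sum of the diagonal values of a bilinear form does not depend on the orthonormal basis. -/
theorem OrthonormalBasis.sum_apply_apply_eq {E ι κ : Type*} [NormedAddCommGroup E]
    [InnerProductSpace ℝ E] [CompleteSpace E] [Fintype ι] [Fintype κ] (B : E →L[ℝ] E →L[ℝ] ℝ)
    (b : OrthonormalBasis ι ℝ E) (c : OrthonormalBasis κ ℝ E) :
    ∑ i, B (b i) (b i) = ∑ i, B (c i) (c i) := by
  let A : E →ₗ[ℝ] E :=
    ((InnerProductSpace.toDual ℝ E).symm.toLinearEquiv.toLinearMap).comp (B : E →ₗ[ℝ] E →L[ℝ] ℝ)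
  have hA (x : E) : ⟪x, A x⟫ = B x x := by
    rw [real_inner_comm]
    exact InnerProductSpace.toDual_symm_apply
  simpa only [hA] using (A.trace_eq_sum_inner b).symm.trans (A.trace_eq_sum_inner c)

/-- An orthonormal family of corank one, completed by a unit normal, computes the sum of the
diagonal values of a bilinear form. -/
theorem Orthonormal.apply_apply_add_sum_eq {E κ : Type*} [NormedAddCommGroup E]
    [InnerProductSpace ℝ E] [FiniteDimensional ℝ E] [Fintype κ] {m : ℕ}
    (hE : Module.finrank ℝ E = m + 1) (B : E →L[ℝ] E →L[ℝ] ℝ) {v : Fin m → E}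
    (hv : Orthonormal ℝ v) {ν : E} (hν : ‖ν‖ = 1) (hvν : ∀ a, ⟪ν, v a⟫ = 0)
    (c : OrthonormalBasis κ ℝ E) :
    B ν ν + ∑ a, B (v a) (v a) = ∑ i, B (c i) (c i) := by
  have ho : Orthonormal ℝ (Matrix.vecCons ν v) := orthonormal_vecCons_iff.2 ⟨hν, hvν, hv⟩
  have hcard : Fintype.card (Fin (m + 1)) = Module.finrank ℝ E := by simp [hE]
  let b : OrthonormalBasis (Fin (m + 1)) ℝ E := OrthonormalBasis.mk ho <| by
    rw [← coe_basisOfOrthonormalOfCardEqFinrank ho hcard, Module.Basis.span_eq]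
  rw [← b.sum_apply_apply_eq B c, Fin.sum_univ_succ]
  simp [b]

/-- The trace of a real bilinear form on `ℂ^m`, in the standard real orthonormal basis. -/
theorem Orthonormal.apply_apply_add_sum_eq_sum_single {m l : ℕ} (hml : 2 * m = l + 1)
    (B : EuclideanSpace ℂ (Fin m) →L[ℝ] EuclideanSpace ℂ (Fin m) →L[ℝ] ℝ)
    {v : Fin l → EuclideanSpace ℂ (Fin m)} (hv : Orthonormal ℝ v)
    {ν : EuclideanSpace ℂ (Fin m)} (hν : ‖ν‖ = 1) (hvν : ∀ a, ⟪ν, v a⟫ = 0) :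
    B ν ν + ∑ a, B (v a) (v a) =
      ∑ j, (B (EuclideanSpace.single j 1) (EuclideanSpace.single j 1) +
        B (EuclideanSpace.single j Complex.I) (EuclideanSpace.single j Complex.I)) := by
  have hE : Module.finrank ℝ (EuclideanSpace ℂ (Fin m)) = l + 1 := by
    rw [← hml, finrank_real_of_complex, finrank_euclideanSpace_fin]
  rw [hv.apply_apply_add_sum_eq hE B hν hvν
    (Pi.orthonormalBasis fun _ : Fin m => Complex.orthonormalBasisOneI), Fintype.sum_sigma]
  simp [Pi.orthonormalBasis_apply, Fin.sum_univ_two, EuclideanSpace.single]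

/-- The complex Hessian in terms of the real second derivative. -/
theorem complexHessian_eq (n : ℕ) {f : EuclideanSpace ℂ (Fin (n+1)) → ℝ}
    {p : EuclideanSpace ℂ (Fin (n+1))} (hf : DifferentiableAt ℝ (fderiv ℝ f) p)
    (j k : Fin (n+1)) :
    complexHessian n f j k p = (1 / 4 : ℂ) *
      (((fderiv ℝ (fderiv ℝ f) p (EuclideanSpace.single j 1) (EuclideanSpace.single k 1) +
        fderiv ℝ (fderiv ℝ f) p (EuclideanSpace.single j Complex.I)
          (EuclideanSpace.single k Complex.I) : ℝ) : ℂ) +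
      Complex.I *
        ((fderiv ℝ (fderiv ℝ f) p (EuclideanSpace.single j 1) (EuclideanSpace.single k Complex.I) -
        fderiv ℝ (fderiv ℝ f) p (EuclideanSpace.single j Complex.I)
          (EuclideanSpace.single k 1) : ℝ) : ℂ)) := by
  have h (u : EuclideanSpace ℂ (Fin (n+1))) :
      HasFDerivAt (fun z => ((fderiv ℝ f z u : ℝ) : ℂ))
        (Complex.ofRealCLM.comp ((fderiv ℝ (fderiv ℝ f) p).flip u)) p :=
    Complex.ofRealCLM.hasFDerivAt.comp p (hf.hasFDerivAt.clm_apply (hasFDerivAt_const u p)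
      |>.congr_fderiv (by ext; simp))
  have hw : HasFDerivAt (wirtingerDZbar n f k) _ p :=
    ((h (EuclideanSpace.single k 1)).add
      ((h (EuclideanSpace.single k Complex.I)).const_mul Complex.I)).const_mul (1 / 2 : ℂ)
  rw [complexHessian, hw.fderiv]
  simp
  linear_combination (-1 / 4 : ℂ) * ((fderiv ℝ (fderiv ℝ f) p (EuclideanSpace.single j Complex.I)
    (EuclideanSpace.single k Complex.I) : ℝ) : ℂ) * Complex.I_sq

/-- The Levi form of a vector `w` is a quarter of the real Hessian traced over `w` and `i w`. -/
theorem sum_complexHessian_mul_mul_conj (n : ℕ) {f : EuclideanSpace ℂ (Fin (n+1)) → ℝ}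
    {p : EuclideanSpace ℂ (Fin (n+1))} (hf : DifferentiableAt ℝ (fderiv ℝ f) p)
    (hsymm : IsSymmSndFDerivAt ℝ f p) (w : EuclideanSpace ℂ (Fin (n+1))) :
    ∑ j, ∑ k, complexHessian n f j k p * w j * starRingEnd ℂ (w k) =
      (((fderiv ℝ (fderiv ℝ f) p w w +
        fderiv ℝ (fderiv ℝ f) p (Complex.I • w) (Complex.I • w)) / 4 : ℝ) : ℂ) := by
  set B := fderiv ℝ (fderiv ℝ f) p with hB
  have hexp (u : EuclideanSpace ℂ (Fin (n+1))) : u = ∑ j, ((u j).re • EuclideanSpace.single j 1 +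
      (u j).im • EuclideanSpace.single j Complex.I) := by
    ext i
    simp [Pi.single_apply, Finset.sum_add_distrib, Complex.re_add_im]
  have hBexp (u : EuclideanSpace ℂ (Fin (n+1))) : B u u = ∑ j, ∑ k,
      ((u j).re * (u k).re * B (EuclideanSpace.single j 1) (EuclideanSpace.single k 1) +
       (u j).re * (u k).im * B (EuclideanSpace.single j 1) (EuclideanSpace.single k Complex.I) +
       (u j).im * (u k).re * B (EuclideanSpace.single j Complex.I) (EuclideanSpace.single k 1) +
       (u j).im * (u k).im *
        B (EuclideanSpace.single j Complex.I) (EuclideanSpace.single k Complex.I)) := by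
    conv_lhs => rw [hexp u]
    simp only [map_sum, sum_apply, map_add, map_smul,
      add_apply, smul_apply, smul_eq_mul]
    rw [Finset.sum_comm]
    refine Finset.sum_congr rfl fun j _ => ?_
    rw [Finset.mul_sum, Finset.mul_sum, ← Finset.sum_add_distrib]
    refine Finset.sum_congr rfl fun k _ => ?_
    ring
  let X (j k : Fin (n+1)) : ℝ :=
    ((w j).im * (w k).re - (w j).re * (w k).im) *
      (B (EuclideanSpace.single j 1) (EuclideanSpace.single k 1) +
        B (EuclideanSpace.single j Complex.I) (EuclideanSpace.single k Complex.I)) +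
    ((w j).re * (w k).re + (w j).im * (w k).im) *
      (B (EuclideanSpace.single j 1) (EuclideanSpace.single k Complex.I) -
        B (EuclideanSpace.single j Complex.I) (EuclideanSpace.single k 1))
  have hX : ∑ j, ∑ k, X j k = 0 := by
    have hanti (j k : Fin (n+1)) : X j k = -X k j := by
      simp only [X, hB, hsymm (EuclideanSpace.single k _) (EuclideanSpace.single j _)]
      ring
    have : ∑ j, ∑ k, X j k = -∑ j, ∑ k, X j k := by
      conv_lhs => rw [Finset.sum_comm]
      simp only [← Finset.sum_neg_distrib]
      exact Finset.sum_congr rfl fun j _ => Finset.sum_congr rfl fun k _ => hanti k j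
    linarith
  rw [hBexp, hBexp]
  apply Complex.ext
  · rw [Complex.ofReal_re, Complex.re_sum, ← Finset.sum_add_distrib, Finset.sum_div]
    refine Finset.sum_congr rfl fun j _ => ?_
    rw [Complex.re_sum, ← Finset.sum_add_distrib, Finset.sum_div]
    refine Finset.sum_congr rfl fun k _ => ?_
    rw [complexHessian_eq n hf, ← hB]
    simp
    ring
  · rw [Complex.ofReal_im, ← zero_div 4, ← hX, Complex.im_sum, Finset.sum_div]
    refine Finset.sum_congr rfl fun j _ => ?_
    rw [Complex.im_sum, Finset.sum_div]
    refine Finset.sum_congr rfl fun k _ => ?_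
    rw [complexHessian_eq n hf, ← hB]
    simp [X]
    ring

/-- **Mean curvature, Levi-mean curvature and characteristic curvature
(equation (16) of the paper):** `(2n+1)·H = 2n·L + C^T`. -/
theorem mean_levi_characteristic_relation (n : ℕ)
    (f : EuclideanSpace ℂ (Fin (n+1)) → ℝ) (hf : ContDiff ℝ ∞ f)
    (p : EuclideanSpace ℂ (Fin (n+1))) (hp : f p = 0)
    (hgrad : gradient f p ≠ 0)
    (ν : EuclideanSpace ℂ (Fin (n+1))) (hν : ν = ‖gradient f p‖⁻¹ • gradient f p)
    (T : EuclideanSpace ℂ (Fin (n+1))) (hT : T = Complex.I • (-ν))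
    (v : Fin (2*n+1) → EuclideanSpace ℂ (Fin (n+1)))
    (hvon : Orthonormal ℝ v)
    (hvtan : ∀ a : Fin (2*n+1), ⟪v a, gradient f p⟫ = 0)
    (H : ℝ) (hH : H = (1 / (2*(n:ℝ)+1)) *
      ∑ a : Fin (2*n+1), iteratedFDeriv ℝ 2 f p ![v a, v a] / ‖gradient f p‖)
    (CT : ℝ) (hCT : CT = iteratedFDeriv ℝ 2 f p ![T, T] / ‖gradient f p‖)
    (L : ℂ) (hL : L = ((2 / ((n:ℝ) * ‖gradient f p‖) : ℝ) : ℂ) *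
      ((∑ j : Fin (n+1), complexHessian n f j j p) -
        ∑ j : Fin (n+1), ∑ k : Fin (n+1),
          complexHessian n f j k p * ν j * starRingEnd ℂ (ν k))) :
    ((2*(n:ℝ)+1) * H : ℂ) = 2*(n:ℝ)*L + (CT : ℂ) := by
  have hf1 : ContDiffAt ℝ 1 (fderiv ℝ f) p :=
    (hf.contDiffAt (x := p)).fderiv_right (m := 1) (by norm_cast)
  have hd : DifferentiableAt ℝ (fderiv ℝ f) p := hf1.differentiableAt one_ne_zero
  have hsymm : IsSymmSndFDerivAt ℝ f p :=
    (hf.contDiffAt (x := p)).isSymmSndFDerivAt (by simp; norm_cast)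
  have hg : ‖gradient f p‖ ≠ 0 := norm_ne_zero_iff.2 hgrad
  have hν1 : ‖ν‖ = 1 := by
    rw [hν]
    exact norm_smul_inv_norm (𝕜 := ℝ) hgrad
  have htr := hvon.apply_apply_add_sum_eq_sum_single (m := n + 1) (by ring)
    (fderiv ℝ (fderiv ℝ f) p) hν1 fun a => by
      rw [hν, real_inner_smul_left, real_inner_comm, hvtan, mul_zero]
  have hlevi := sum_complexHessian_mul_mul_conj n hd hsymm ν
  have hdiag : ∑ j, complexHessian n f j j p =
      (((fderiv ℝ (fderiv ℝ f) p ν ν +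
        ∑ a, fderiv ℝ (fderiv ℝ f) p (v a) (v a)) / 4 : ℝ) : ℂ) := by
    rw [htr, Finset.sum_div, Complex.ofReal_sum]
    refine Finset.sum_congr rfl fun j _ => ?_
    rw [complexHessian_eq n hd, hsymm (EuclideanSpace.single j Complex.I) (EuclideanSpace.single j 1)]
    push_cast
    ring
  have hn : (2 * (n : ℝ) + 1) ≠ 0 := by positivity
  have hH' : (2 * (n : ℝ) + 1) * H =
      (∑ a, fderiv ℝ (fderiv ℝ f) p (v a) (v a)) / ‖gradient f p‖ := by
    rw [hH, ← mul_assoc, mul_one_div_cancel hn, one_mul, Finset.sum_div]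
    simp [iteratedFDeriv_two_apply]
  have hCT' : CT =
      fderiv ℝ (fderiv ℝ f) p (Complex.I • ν) (Complex.I • ν) / ‖gradient f p‖ := by
    rw [hCT, hT]
    simp [iteratedFDeriv_two_apply]
  obtain rfl | hn0 := Nat.eq_zero_or_pos n
  · have hνν : ν 0 * starRingEnd ℂ (ν 0) = 1 := by
      have := EuclideanSpace.norm_sq_eq ν
      rw [hν1, one_pow, Fin.sum_univ_one] at this
      rw [Complex.mul_conj, Complex.normSq_eq_norm_sq, ← this, Complex.ofReal_one]
    have hz : (∑ j, complexHessian 0 f j j p) =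
        ∑ j, ∑ k, complexHessian 0 f j k p * ν j * starRingEnd ℂ (ν k) := by
      simp [mul_assoc, hνν]
    rw [hlevi, hdiag, Complex.ofReal_inj] at hz
    have : (2 * ((0 : ℕ) : ℝ) + 1) * H = CT := by
      rw [hH', hCT']
      congr 1
      linarith
    rw [← this]
    simp
  · have hL' : L = (((2 / ((n : ℝ) * ‖gradient f p‖)) *
        ((∑ a, fderiv ℝ (fderiv ℝ f) p (v a) (v a) -
          fderiv ℝ (fderiv ℝ f) p (Complex.I • ν) (Complex.I • ν)) / 4) : ℝ) : ℂ) := by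
      rw [hL, hlevi, hdiag]
      push_cast
      ring
    have key : (2 * (n : ℝ) + 1) * H = 2 * (n : ℝ) * ((2 / ((n : ℝ) * ‖gradient f p‖)) *
        ((∑ a, fderiv ℝ (fderiv ℝ f) p (v a) (v a) -
          fderiv ℝ (fderiv ℝ f) p (Complex.I • ν) (Complex.I • ν)) / 4)) + CT := by
      have hn0' : (n : ℝ) ≠ 0 := by positivity
      rw [hH', hCT']
      field_simp
      ring
    rw [hL']
    exact_mod_cast key
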